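/- Let f ∈ ℋ with f(−1,·) = ℒ(φ), and suppose |φ(u)| u^{−Re(γ)} → 0 as u → 0⁺ for some γ with Re(γ) > −1. Fix s ∈ ℂ, s ≠ 0, and suppose that f(s, t) = m^{−s} f(s, m t) for every integer m ≥ 1 and every t > 0 (principal power m^{−s}). For an integer m ≥ 1, j ∈ {0,…,m−1}, and integers n ≥ 0 define S_j(n) = (1/s)[(B f_s)(1+n) − m^s (B f_s)((n−j)/m + 1)] − (1/s)(1 − m^s)(B f_s)(1), all Bernoulli series converging absolutely and locally uniformly. Then for every integer m ≥ 1 and every integer n ≥ 0: (1/m) Σ_{j=0}^{m−1} S_j(n) = −(1 − m^s)·(1/s)·(B f_s)(1). -/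

import Mathlib

open MeasureTheory Filter Set

noncomputable section

/-- The Laplace transform `ℒ(φ)(t) = ∫₀^∞ e^{−tu} φ(u) du`. -/
def Lap (φ : ℝ → ℂ) (t : ℝ) : ℂ :=
  ∫ u in Ioi (0:ℝ), Complex.exp (-(t * u : ℝ)) * φ u

/-- Membership in the domain `𝒟(ℒ)` of the Laplace transform:
measurable, integrable on `(0,R)` for all `R > 0`, and
`∫₀^∞ e^{−xu} |φ(u)| du < ∞` for every `x > 0`. -/
def MemDL (φ : ℝ → ℂ) : Prop :=
  Measurable φ ∧
  (∀ R > 0, IntegrableOn φ (Ioo 0 R)) ∧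
  (∀ x > 0, IntegrableOn (fun u => Real.exp (-(x * u)) * ‖φ u‖) (Ioi 0))

/-- The forward difference operator with step `h`: `(Δ_h f)(t) = f(t+h) − f(t)`. -/
def Dh (h : ℝ) (f : ℝ → ℂ) : ℝ → ℂ := fun t => f (t + h) - f t

/-- The `n`-th term of the Bernoulli-operator series: `(−1)^n (Δ_h^n f)(t)/(n+1)`. -/
def BTerm (h : ℝ) (f : ℝ → ℂ) (n : ℕ) (t : ℝ) : ℂ :=
  ((-1 : ℂ) ^ n / (n + 1)) * (Dh h)^[n] f t

/-- The Bernoulli operator `(B_h f)(t) = Σ_{n≥0} (−1)^n (Δ_h^n f)(t)/(n+1)`. -/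
def Bop (h : ℝ) (f : ℝ → ℂ) (t : ℝ) : ℂ := ∑' n : ℕ, BTerm h f n t

/-- Generalized binomial coefficient `binom(h,n) = h(h−1)⋯(h−n+1)/n!`. -/
def gbinom (h : ℝ) (n : ℕ) : ℝ :=
  (∏ i ∈ Finset.range n, (h - i)) / n.factorial

/-- The `n`-th term of the Newton series: `binom(h,n) (Δ^n f)(t)`. -/
def NTerm (h : ℝ) (f : ℝ → ℂ) (n : ℕ) (t : ℝ) : ℂ :=
  (gbinom h n : ℂ) * (Dh 1)^[n] f t

/-- The fractional shift `(E^h f)(t) = Σ_{n≥0} binom(h,n) (Δ^n f)(t)`. -/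
def Nop (h : ℝ) (f : ℝ → ℂ) (t : ℝ) : ℂ := ∑' n : ℕ, NTerm h f n t

/-- The series `Σ g n` converges absolutely (pointwise on `S`) and its partial sums
converge locally uniformly on `S`. -/
def ALUOn (g : ℕ → ℝ → ℂ) (S : Set ℝ) : Prop :=
  (∀ t ∈ S, Summable fun n : ℕ => ‖g n t‖) ∧
  TendstoLocallyUniformlyOn (fun N t => ∑ n ∈ Finset.range N, g n t)
    (fun t => ∑' n : ℕ, g n t) atTop S

/-- The Laplace–Mellin transform `f_{−s}(t) = (1/Γ(s)) ∫₀^∞ e^{−tu} φ(u) u^{s−1} du`. -/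
def LM (φ : ℝ → ℂ) (s : ℂ) (t : ℝ) : ℂ :=
  (1 / Complex.Gamma s) *
    ∫ u in Ioi (0:ℝ), Complex.exp (-(t * u : ℝ)) * φ u * (u : ℂ) ^ (s - 1)

/-- `φ(u) = o(u^γ)` as `u → 0⁺`, i.e. `|φ(u)| u^{−Re γ} → 0`. -/
def SmallO (φ : ℝ → ℂ) (γ : ℂ) : Prop :=
  Tendsto (fun u : ℝ => ‖φ u‖ * u ^ (-γ.re)) (nhdsWithin 0 (Ioi 0)) (nhds 0)

/-- Membership in `𝒟^ι(ℒ)`: `φ ∈ 𝒟(ℒ)` dominated by a nondecreasing `ψ ∈ 𝒟(ℒ)`. -/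
def MemDLi (φ : ℝ → ℂ) : Prop :=
  MemDL φ ∧ ∃ ψ : ℝ → ℝ, MemDL (fun u => (ψ u : ℂ)) ∧ MonotoneOn ψ (Ioi 0) ∧
    ∀ u ∈ Ioi (0:ℝ), ‖φ u‖ ≤ ψ u

/-- Membership in the class `ℋ`, with the witness `φ` recorded:
(1) `t ↦ f(s,t)` differentiable on `(0,∞)`;
(2) `s ↦ f(s,t)` and `s ↦ ∂ₜf(s,t)` entire;
(3) `f(−1,·) = ℒ(φ)` with `φ ∈ 𝒟^ι(ℒ)`;
(4) `f(−s,t)` is the Laplace–Mellin transform of `φ` for `Re s > 1`. -/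
def MemHwith (f : ℂ → ℝ → ℂ) (φ : ℝ → ℂ) : Prop :=
  (∀ s : ℂ, ∀ t ∈ Ioi (0:ℝ), DifferentiableAt ℝ (f s) t) ∧
  (∀ t ∈ Ioi (0:ℝ), Differentiable ℂ fun s => f s t) ∧
  (∀ t ∈ Ioi (0:ℝ), Differentiable ℂ fun s => deriv (f s) t) ∧
  MemDLi φ ∧
  (∀ t ∈ Ioi (0:ℝ), f (-1) t = Lap φ t) ∧
  (∀ s : ℂ, 1 < s.re → ∀ t ∈ Ioi (0:ℝ), f (-s) t = LM φ s t)

/-- Membership in the class `ℋ`. -/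
def MemH (f : ℂ → ℝ → ℂ) : Prop := ∃ φ : ℝ → ℂ, MemHwith f φ

/-- The Hurwitz zeta function `ζ(s,x)` for real `x > 0`: the meromorphic continuation in `s`
of `Σ_{k≥0} (k+x)^{−s}`, expressed via Mathlib's `HurwitzZeta.hurwitzZeta` on `ℝ/ℤ`. -/
def hurwitz (s : ℂ) (x : ℝ) : ℂ :=
  HurwitzZeta.hurwitzZeta (↑x : UnitAddCircle) s -
    ∑ k ∈ Finset.range ⌊x⌋₊,
      (if (k : ℝ) + Int.fract x = 0 then 0
       else (((k : ℝ) + Int.fract x : ℝ) : ℂ) ^ (-s))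

end

/-- The kernel `(1 - e^{-u})^n e^{-tu}` representing the `n`-th difference of `t ↦ e^{-tu}`. -/
noncomputable def diffKernel (n : ℕ) (t u : ℝ) : ℝ :=
  (1 - Real.exp (-u)) ^ n * Real.exp (-(t * u))

/-- The real Mellin transform of `diffKernel`. -/
noncomputable def diffKernelMoment (n : ℕ) (t r : ℝ) : ℝ :=
  ∫ u in Ioi (0:ℝ), u ^ (r - 1) * diffKernel n t u

lemma one_sub_exp_neg_nonneg {u : ℝ} (hu : 0 < u) : 0 ≤ 1 - Real.exp (-u) := by
  have := Real.exp_le_one_iff.mpr (neg_nonpos.mpr hu.le)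
  linarith

lemma one_sub_exp_neg_pos {u : ℝ} (hu : 0 < u) : 0 < 1 - Real.exp (-u) := by
  have := Real.exp_lt_one_iff.mpr (neg_lt_zero.mpr hu)
  linarith

lemma one_sub_exp_neg_le (u : ℝ) : 1 - Real.exp (-u) ≤ u := by
  have := Real.add_one_le_exp (-u)
  linarith

lemma diffKernel_nonneg (n : ℕ) (t : ℝ) {u : ℝ} (hu : 0 < u) : 0 ≤ diffKernel n t u :=
  mul_nonneg (pow_nonneg (one_sub_exp_neg_nonneg hu) n) (Real.exp_pos _).le

lemma diffKernel_le (n : ℕ) (t : ℝ) {u : ℝ} (hu : 0 < u) :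
    diffKernel n t u ≤ u ^ n * Real.exp (-(t * u)) :=
  mul_le_mul_of_nonneg_right
    (pow_le_pow_left₀ (one_sub_exp_neg_nonneg hu) (one_sub_exp_neg_le u) n) (Real.exp_pos _).le

lemma diffKernel_anti (n : ℕ) {a t u : ℝ} (hat : a ≤ t) (hu : 0 < u) :
    diffKernel n t u ≤ diffKernel n a u :=
  mul_le_mul_of_nonneg_left (Real.exp_le_exp.mpr (by nlinarith))
    (pow_nonneg (one_sub_exp_neg_nonneg hu) n)

lemma continuous_diffKernel (n : ℕ) (t : ℝ) : Continuous (diffKernel n t) := by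
  unfold diffKernel
  fun_prop

lemma integrableOn_rpow_mul_exp_neg_mul {t r : ℝ} (ht : 0 < t) (hr : 0 < r) :
    IntegrableOn (fun u : ℝ => u ^ (r - 1) * Real.exp (-(t * u))) (Ioi 0) := by
  have h := integrableOn_rpow_mul_exp_neg_mul_rpow (p := 1) (s := r - 1) (b := t)
    (by linarith) one_pos ht
  simpa using h

lemma integrableOn_rpow_mul_diffKernel {n : ℕ} {t r : ℝ} (ht : 0 < t) (hr : 0 < n + r) :
    IntegrableOn (fun u : ℝ => u ^ (r - 1) * diffKernel n t u) (Ioi 0) := by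
  refine (integrableOn_rpow_mul_exp_neg_mul ht hr).mono' ?_ ?_
  · exact (Measurable.mul (by fun_prop) (continuous_diffKernel n t).measurable).aestronglyMeasurable
  · refine (ae_restrict_mem measurableSet_Ioi).mono fun u (hu : 0 < u) => ?_
    rw [Real.norm_of_nonneg (mul_nonneg (Real.rpow_nonneg hu.le _) (diffKernel_nonneg n t hu))]
    calc u ^ (r - 1) * diffKernel n t u ≤ u ^ (r - 1) * (u ^ n * Real.exp (-(t * u))) :=
          mul_le_mul_of_nonneg_left (diffKernel_le n t hu) (Real.rpow_nonneg hu.le _)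
      _ = u ^ (n + r - 1) * Real.exp (-(t * u)) := by
          rw [← mul_assoc, ← Real.rpow_add_natCast hu.ne']
          ring_nf

lemma diffKernelMoment_nonneg (n : ℕ) (t r : ℝ) : 0 ≤ diffKernelMoment n t r :=
  setIntegral_nonneg measurableSet_Ioi fun _ hu =>
    mul_nonneg (Real.rpow_nonneg (le_of_lt hu) _) (diffKernel_nonneg n t hu)

lemma hasSum_one_sub_exp_neg_pow_div {u : ℝ} (hu : 0 < u) :
    HasSum (fun n : ℕ => (1 - Real.exp (-u)) ^ (n + 1) / ((n : ℝ) + 1)) u := by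
  have h := Real.hasSum_pow_div_log_of_abs_lt_one (x := 1 - Real.exp (-u)) (by
    rw [abs_of_nonneg (one_sub_exp_neg_nonneg hu)]
    linarith [Real.exp_pos (-u)])
  simpa using h

lemma sum_diffKernel_div_le (N : ℕ) (t : ℝ) {u : ℝ} (hu : 0 < u) (M : ℕ) :
    ∑ k ∈ Finset.range M, diffKernel (N + 1 + k) t u / ((N + 1 + k : ℕ) + 1 : ℝ) ≤
      u * diffKernel N t u := by
  have hx := one_sub_exp_neg_nonneg hu
  calc ∑ k ∈ Finset.range M, diffKernel (N + 1 + k) t u / ((N + 1 + k : ℕ) + 1 : ℝ)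
      ≤ ∑ k ∈ Finset.range M, diffKernel N t u *
          ((1 - Real.exp (-u)) ^ (k + 1) / ((k : ℝ) + 1)) := by
        refine Finset.sum_le_sum fun k _ => ?_
        have : diffKernel (N + 1 + k) t u = diffKernel N t u * (1 - Real.exp (-u)) ^ (k + 1) := by
          unfold diffKernel
          ring
        rw [this, ← mul_div_assoc]
        refine div_le_div_of_nonneg_left
          (mul_nonneg (diffKernel_nonneg N t hu) (pow_nonneg hx _)) (by positivity) ?_
        push_cast
        linarith [(Nat.cast_nonneg N : (0:ℝ) ≤ N)]
    _ = diffKernel N t u *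
          ∑ k ∈ Finset.range M, (1 - Real.exp (-u)) ^ (k + 1) / ((k : ℝ) + 1) := by
        rw [Finset.mul_sum]
    _ ≤ diffKernel N t u * u := mul_le_mul_of_nonneg_left
        (sum_le_hasSum _ (fun k _ => by positivity) (hasSum_one_sub_exp_neg_pow_div hu))
        (diffKernel_nonneg N t hu)
    _ = u * diffKernel N t u := mul_comm _ _

lemma summable_diffKernelMoment_div {t r : ℝ} (ht : 0 < t) :
    Summable fun n : ℕ => diffKernelMoment n t r / ((n : ℝ) + 1) := by
  obtain ⟨N, hN⟩ := exists_nat_gt (-r)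
  rw [← summable_nat_add_iff (N + 1)]
  refine summable_of_sum_range_le (c := diffKernelMoment N t (r + 1))
    (fun n => div_nonneg (diffKernelMoment_nonneg _ _ _) (by positivity)) fun M => ?_
  have hint (k : ℕ) : IntegrableOn
      (fun u : ℝ => u ^ (r - 1) * diffKernel (k + (N + 1)) t u) (Ioi 0) :=
    integrableOn_rpow_mul_diffKernel ht (by
      push_cast
      linarith [(Nat.cast_nonneg k : (0:ℝ) ≤ k)])
  simp only [diffKernelMoment, ← integral_div]
  rw [← integral_finsetSum _ fun k _ => (hint k).div_const _]
  refine setIntegral_mono_on (integrable_finsetSum _ fun k _ => (hint k).div_const _)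
    (integrableOn_rpow_mul_diffKernel ht (by linarith)) measurableSet_Ioi
    fun u (hu : 0 < u) => ?_
  have h := mul_le_mul_of_nonneg_left (sum_diffKernel_div_le N t hu M)
    (Real.rpow_nonneg hu.le (r - 1))
  rw [Finset.mul_sum, ← mul_assoc, ← Real.rpow_add_one hu.ne'] at h
  refine le_trans (le_of_eq (Finset.sum_congr rfl fun k _ => ?_)) (h.trans_eq ?_)
  · rw [add_comm k, mul_div_assoc]
  · ring_nf

/-- The Mellin transform of `diffKernel` as a function of a complex variable. -/
noncomputable def diffKernelMellin (n : ℕ) (t : ℝ) : ℂ → ℂ :=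
  mellin fun u => (diffKernel n t u : ℂ)

lemma diffKernel_isBigO_atTop (n : ℕ) (t : ℝ) :
    (fun u => (diffKernel n t u : ℂ)) =O[atTop] fun u => Real.exp (-t * u) := by
  refine Asymptotics.IsBigO.of_bound 1 ((eventually_gt_atTop 0).mono fun u hu => ?_)
  rw [Complex.norm_of_nonneg (diffKernel_nonneg n t hu), one_mul, Real.norm_of_nonneg
    (Real.exp_pos _).le, neg_mul]
  exact mul_le_of_le_one_left (Real.exp_pos _).le
    (pow_le_one₀ (one_sub_exp_neg_nonneg hu) (by linarith [Real.exp_pos (-u)]))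

lemma diffKernel_isBigO_zero (n : ℕ) {t : ℝ} (ht : 0 ≤ t) :
    (fun u => (diffKernel n t u : ℂ)) =O[nhdsWithin 0 (Ioi 0)] fun u => u ^ (-(-n : ℝ)) := by
  refine Asymptotics.IsBigO.of_bound 1 (eventually_mem_nhdsWithin.mono fun u (hu : 0 < u) => ?_)
  rw [Complex.norm_of_nonneg (diffKernel_nonneg n t hu), one_mul, neg_neg, Real.rpow_natCast,
    Real.norm_of_nonneg (by positivity)]
  exact (diffKernel_le n t hu).trans
    (mul_le_of_le_one_right (by positivity) (Real.exp_le_one_iff.mpr (by nlinarith)))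

lemma locallyIntegrableOn_diffKernel (n : ℕ) (t : ℝ) :
    LocallyIntegrableOn (fun u => (diffKernel n t u : ℂ)) (Ioi 0) :=
  ((Complex.continuous_ofReal.comp (continuous_diffKernel n t)).locallyIntegrable).locallyIntegrableOn _

lemma mellinConvergent_diffKernel {n : ℕ} {t : ℝ} (ht : 0 < t) {z : ℂ} (hz : -n < z.re) :
    MellinConvergent (fun u => (diffKernel n t u : ℂ)) z :=
  mellinConvergent_of_isBigO_rpow_exp ht (locallyIntegrableOn_diffKernel n t)
    (diffKernel_isBigO_atTop n t) (diffKernel_isBigO_zero n ht.le) hz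

lemma differentiableAt_diffKernelMellin {n : ℕ} {t : ℝ} (ht : 0 < t) {z : ℂ} (hz : -n < z.re) :
    DifferentiableAt ℂ (diffKernelMellin n t) z :=
  mellin_differentiableAt_of_isBigO_rpow_exp ht (locallyIntegrableOn_diffKernel n t)
    (diffKernel_isBigO_atTop n t) (diffKernel_isBigO_zero n ht.le) hz

lemma norm_cpow_smul_diffKernel (n : ℕ) (t : ℝ) (z : ℂ) {u : ℝ} (hu : 0 < u) :
    ‖(u : ℂ) ^ (z - 1) • (diffKernel n t u : ℂ)‖ = u ^ (z.re - 1) * diffKernel n t u := by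
  rw [norm_smul, Complex.norm_cpow_eq_rpow_re_of_pos hu,
    Complex.norm_of_nonneg (diffKernel_nonneg n t hu), Complex.sub_re, Complex.one_re]

lemma integral_norm_diffKernel (n : ℕ) (t : ℝ) (z : ℂ) :
    ∫ u in Ioi (0:ℝ), ‖(u : ℂ) ^ (z - 1) • (diffKernel n t u : ℂ)‖ =
      diffKernelMoment n t z.re :=
  setIntegral_congr_fun measurableSet_Ioi fun _ hu => norm_cpow_smul_diffKernel n t z hu

lemma norm_diffKernelMellin_le (n : ℕ) (t : ℝ) (z : ℂ) :
    ‖diffKernelMellin n t z‖ ≤ diffKernelMoment n t z.re :=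
  (norm_integral_le_integral_norm _).trans_eq (integral_norm_diffKernel n t z)

lemma diffKernelMoment_le {n : ℕ} {a t r R : ℝ} (ha : 0 < a) (hat : a ≤ t)
    (hr : |r| ≤ R) (hn : R < n) :
    diffKernelMoment n t r ≤ diffKernelMoment n a (-R) + diffKernelMoment n a R := by
  obtain ⟨h1, h2⟩ := abs_le.mp hr
  have i1 : IntegrableOn (fun u : ℝ => u ^ (-R - 1) * diffKernel n a u) (Ioi 0) :=
    integrableOn_rpow_mul_diffKernel ha (by linarith)
  have i2 : IntegrableOn (fun u : ℝ => u ^ (R - 1) * diffKernel n a u) (Ioi 0) :=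
    integrableOn_rpow_mul_diffKernel ha (by linarith)
  unfold diffKernelMoment
  rw [← integral_add i1 i2]
  refine setIntegral_mono_on (integrableOn_rpow_mul_diffKernel (ha.trans_le hat) (by linarith))
    (i1.add i2) measurableSet_Ioi fun u (hu : 0 < u) => ?_
  rw [← add_mul]
  refine mul_le_mul ?_ (diffKernel_anti n hat hu) (diffKernel_nonneg n t hu) (by positivity)
  rcases le_total u 1 with h | h
  · exact (Real.rpow_le_rpow_of_exponent_ge hu h (by linarith)).trans
      (le_add_of_nonneg_right (by positivity))
  · exact (Real.rpow_le_rpow_of_exponent_le h (by linarith)).trans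
      (le_add_of_nonneg_left (by positivity))

lemma Dh_iterate_eq_sum (h : ℝ) (g : ℝ → ℂ) (n : ℕ) (t : ℝ) :
    (Dh h)^[n] g t = ∑ k ∈ Finset.range (n + 1),
      ((-1 : ℤ) ^ (n - k) * (n.choose k : ℤ)) • g (t + k • h) :=
  fwdDiff_iter_eq_sum_shift h g n t

lemma differentiable_Dh_iterate_cpow (n : ℕ) {t : ℝ} (ht : 0 < t) :
    Differentiable ℂ fun s : ℂ => (Dh 1)^[n] (fun x : ℝ => (x : ℂ) ^ s) t := by
  simp only [Dh_iterate_eq_sum]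
  refine Differentiable.fun_sum fun k _ => Differentiable.const_smul
    (fun s => differentiableAt_id.const_cpow (Or.inl ?_)) _
  have : 0 < t + k • (1:ℝ) := by positivity
  exact_mod_cast this.ne'

lemma diffKernelMellin_zero {t : ℝ} (ht : 0 < t) {z : ℂ} (hz : 0 < z.re) :
    diffKernelMellin 0 t z = (t : ℂ) ^ (-z) * Complex.Gamma z := by
  have h := Complex.integral_cpow_mul_exp_neg_mul_Ioi hz ht
  rw [one_div, Complex.inv_cpow _ _ (by
    rw [Complex.arg_ofReal_of_nonneg ht.le]; exact Real.pi_pos.ne), ← Complex.cpow_neg] at h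
  rw [← h]
  refine setIntegral_congr_fun measurableSet_Ioi fun u _ => ?_
  simp [diffKernel]

lemma diffKernelMellin_succ (n : ℕ) {t : ℝ} (ht : 0 < t) {z : ℂ} (hz : -n < z.re) :
    diffKernelMellin (n + 1) t z = diffKernelMellin n t z - diffKernelMellin n (t + 1) z := by
  unfold diffKernelMellin mellin
  rw [← integral_sub (mellinConvergent_diffKernel ht hz)
    (mellinConvergent_diffKernel (by linarith) hz)]
  refine setIntegral_congr_fun measurableSet_Ioi fun u _ => ?_
  rw [← smul_sub, ← Complex.ofReal_sub]
  have : diffKernel (n + 1) t u = diffKernel n t u - diffKernel n (t + 1) u := by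
    unfold diffKernel
    rw [show -((t + 1) * u) = -(t * u) + -u by ring, Real.exp_add]
    ring
  simp only [this]

lemma Dh_iterate_cpow_of_re_neg {s : ℂ} (hs : s.re < 0) (n : ℕ) {t : ℝ} (ht : 0 < t) :
    (Dh 1)^[n] (fun x : ℝ => (x : ℂ) ^ s) t =
      (-1) ^ n * (Complex.Gamma (-s))⁻¹ * diffKernelMellin n t (-s) := by
  have hz : 0 < (-s).re := by simpa using hs
  induction n generalizing t with
  | zero =>
    rw [diffKernelMellin_zero ht hz]
    have := Complex.Gamma_ne_zero_of_re_pos hz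
    simp only [Function.iterate_zero, id, neg_neg, pow_zero]
    field_simp
  | succ n ih =>
    rw [Function.iterate_succ_apply', Dh, ih ht, ih (by linarith),
      diffKernelMellin_succ n ht (by linarith [(Nat.cast_nonneg n : (0:ℝ) ≤ n)])]
    ring

lemma Dh_iterate_cpow {s : ℂ} {n : ℕ} (hs : s.re < n) {t : ℝ} (ht : 0 < t) :
    (Dh 1)^[n] (fun x : ℝ => (x : ℂ) ^ s) t =
      (-1) ^ n * (Complex.Gamma (-s))⁻¹ * diffKernelMellin n t (-s) := by
  have hU : IsOpen {s : ℂ | s.re < n} := isOpen_lt Complex.continuous_re continuous_const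
  have hn : (0:ℝ) ≤ n := Nat.cast_nonneg n
  refine AnalyticOnNhd.eqOn_of_preconnected_of_eventuallyEq (U := {s : ℂ | s.re < n})
    (f := fun s : ℂ => (Dh 1)^[n] (fun x : ℝ => (x : ℂ) ^ s) t)
    (g := fun s => (-1) ^ n * (Complex.Gamma (-s))⁻¹ * diffKernelMellin n t (-s))
    ((differentiable_Dh_iterate_cpow n ht).differentiableOn.analyticOnNhd hU)
    (DifferentiableOn.analyticOnNhd (fun z (hz : z.re < n) => ?_) hU)
    (convex_halfSpace_re_lt _).isPreconnected (z₀ := -1) (by simp; linarith) ?_ hs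
  · have h1 : DifferentiableAt ℂ (fun s : ℂ => (Complex.Gamma (-s))⁻¹) z :=
      (Complex.differentiable_one_div_Gamma.comp differentiable_neg) z
    have h2 : DifferentiableAt ℂ (fun s : ℂ => diffKernelMellin n t (-s)) z :=
      DifferentiableAt.comp z
        (differentiableAt_diffKernelMellin ht (by simpa using hz)) differentiable_neg.differentiableAt
    exact ((h1.const_mul _).mul h2).differentiableWithinAt
  · have : {s : ℂ | s.re < 0} ∈ nhds (-1 : ℂ) :=
      (isOpen_lt Complex.continuous_re continuous_const).mem_nhds (by simp)
    filter_upwards [this] with z hz using Dh_iterate_cpow_of_re_neg hz n ht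

lemma norm_BTerm_cpow_le {s : ℂ} {n : ℕ} (hs : s.re < n) {t : ℝ} (ht : 0 < t) :
    ‖BTerm 1 (fun x : ℝ => (x : ℂ) ^ s) n t‖ ≤
      ‖(Complex.Gamma (-s))⁻¹‖ * (diffKernelMoment n t (-s.re) / ((n : ℝ) + 1)) := by
  have h := norm_diffKernelMellin_le n t (-s)
  rw [Complex.neg_re] at h
  have hn : ‖(n : ℂ) + 1‖ = (n : ℝ) + 1 := by
    exact_mod_cast Complex.norm_natCast (n + 1)
  rw [BTerm, Dh_iterate_cpow hs ht]
  simp only [norm_mul, norm_div, norm_pow, norm_neg, norm_one, one_pow, one_mul, hn]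
  calc 1 / ((n : ℝ) + 1) * (‖(Complex.Gamma (-s))⁻¹‖ * ‖diffKernelMellin n t (-s)‖)
      = ‖(Complex.Gamma (-s))⁻¹‖ * (‖diffKernelMellin n t (-s)‖ / ((n : ℝ) + 1)) := by ring
    _ ≤ _ := by gcongr

lemma exists_summable_bound_BTerm_cpow {a : ℝ} (ha : 0 < a) (R : ℝ) :
    ∃ v : ℕ → ℝ, Summable v ∧ ∀ᶠ n : ℕ in atTop, ∀ s : ℂ, ‖s‖ ≤ R → ∀ t : ℝ, a ≤ t →
      ‖BTerm 1 (fun x : ℝ => (x : ℂ) ^ s) n t‖ ≤ v n := by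
  obtain ⟨C, hC⟩ := (isCompact_closedBall (0 : ℂ) R).exists_bound_of_continuousOn
    (Complex.differentiable_one_div_Gamma.continuous.comp continuous_neg).continuousOn
  refine ⟨fun n => C * (diffKernelMoment n a (-R) / ((n : ℝ) + 1) +
    diffKernelMoment n a R / ((n : ℝ) + 1)), ((summable_diffKernelMoment_div ha).add
    (summable_diffKernelMoment_div ha)).mul_left C, ?_⟩
  filter_upwards [tendsto_natCast_atTop_atTop.eventually_gt_atTop R] with n hn s hs t hat
  have hre : |s.re| ≤ R := (Complex.abs_re_le_norm s).trans hs
  have hCs := hC s (by simpa using hs)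
  refine (norm_BTerm_cpow_le (((le_abs_self _).trans hre).trans_lt hn)
    (ha.trans_le hat)).trans ?_
  rw [← add_div]
  exact mul_le_mul hCs
    (div_le_div_of_nonneg_right (diffKernelMoment_le ha hat (by rwa [abs_neg]) hn)
      (by positivity))
    (div_nonneg (diffKernelMoment_nonneg _ _ _) (by positivity)) ((norm_nonneg _).trans hCs)

lemma summable_norm_BTerm_cpow (s : ℂ) {t : ℝ} (ht : 0 < t) :
    Summable fun n => ‖BTerm 1 (fun x : ℝ => (x : ℂ) ^ s) n t‖ := by
  obtain ⟨v, hv, h⟩ := exists_summable_bound_BTerm_cpow ht ‖s‖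
  refine Summable.of_norm_bounded_eventually_nat hv (h.mono fun n hn => ?_)
  rw [norm_norm]
  exact hn s le_rfl t le_rfl

lemma ALUOn_BTerm_cpow (s : ℂ) : ALUOn (BTerm 1 fun x : ℝ => (x : ℂ) ^ s) (Ioi 0) := by
  refine ⟨fun t ht => summable_norm_BTerm_cpow s ht,
    tendstoLocallyUniformlyOn_of_forall_exists_nhds fun x (hx : 0 < x) =>
      ⟨Ici (x / 2), mem_nhdsWithin_of_mem_nhds (Ici_mem_nhds (by linarith)), ?_⟩⟩
  obtain ⟨v, hv, h⟩ := exists_summable_bound_BTerm_cpow (half_pos hx) ‖s‖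
  exact tendstoUniformlyOn_tsum_nat_eventually hv (h.mono fun n hn t ht => hn s le_rfl t ht)

lemma differentiable_Bop_cpow {t : ℝ} (ht : 0 < t) :
    Differentiable ℂ fun s : ℂ => Bop 1 (fun x : ℝ => (x : ℂ) ^ s) t := by
  intro s₀
  obtain ⟨v, hv, h⟩ := exists_summable_bound_BTerm_cpow ht (‖s₀‖ + 1)
  have hu := tendstoUniformlyOn_tsum_nat_eventually
    (f := fun n (s : ℂ) => BTerm 1 (fun x : ℝ => (x : ℂ) ^ s) n t)
    (s := Metric.ball 0 (‖s₀‖ + 1)) hv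
    (h.mono fun n hn s hs => hn s (by simpa using (Metric.mem_ball.mp hs).le) t le_rfl)
  refine (hu.tendstoLocallyUniformlyOn.differentiableOn (Eventually.of_forall fun N => ?_)
    Metric.isOpen_ball).differentiableAt (Metric.isOpen_ball.mem_nhds (by simp))
  exact (Differentiable.fun_sum fun n _ =>
    (differentiable_Dh_iterate_cpow n ht).const_mul _).differentiableOn

/-- The kernel `e^{-tu} u / (1 - e^{-u})` representing `B` applied to `t ↦ e^{-tu}`. -/
noncomputable def bernoulliKernel (t u : ℝ) : ℝ :=
  Real.exp (-(t * u)) * (u / (1 - Real.exp (-u)))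

lemma div_one_sub_exp_neg_le {u : ℝ} (hu : 0 < u) : u / (1 - Real.exp (-u)) ≤ 1 + u := by
  rw [div_le_iff₀ (one_sub_exp_neg_pos hu), Real.exp_neg]
  have h := mul_le_mul_of_nonneg_right (Real.add_one_le_exp u) (inv_nonneg.mpr (Real.exp_pos u).le)
  rw [mul_inv_cancel₀ (Real.exp_pos u).ne'] at h
  linarith

lemma bernoulliKernel_nonneg (t : ℝ) {u : ℝ} (hu : 0 < u) : 0 ≤ bernoulliKernel t u :=
  mul_nonneg (Real.exp_pos _).le (div_nonneg hu.le (one_sub_exp_neg_nonneg hu))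

lemma hasSum_diffKernel_div (t : ℝ) {u : ℝ} (hu : 0 < u) :
    HasSum (fun n : ℕ => diffKernel n t u / ((n : ℝ) + 1)) (bernoulliKernel t u) := by
  have hx := (one_sub_exp_neg_pos hu).ne'
  have h := (hasSum_one_sub_exp_neg_pow_div hu).mul_left
    (Real.exp (-(t * u)) / (1 - Real.exp (-u)))
  rw [show Real.exp (-(t * u)) / (1 - Real.exp (-u)) * u = bernoulliKernel t u by
    unfold bernoulliKernel
    ring] at h
  refine h.congr_fun fun n => ?_
  unfold diffKernel
  field_simp
  ring

lemma mellinConvergent_bernoulliKernel {t : ℝ} (ht : 0 < t) {z : ℂ} (hz : 0 < z.re) :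
    MellinConvergent (fun u => (bernoulliKernel t u : ℂ)) z := by
  refine ((integrableOn_rpow_mul_exp_neg_mul ht hz).add
    (integrableOn_rpow_mul_exp_neg_mul ht (add_pos hz one_pos))).mono' ?_ ?_
  · have : Measurable (bernoulliKernel t) := by
      unfold bernoulliKernel
      fun_prop
    have hpow : Measurable fun u : ℝ => (u : ℂ) ^ (z - 1) := by fun_prop
    exact (hpow.smul (Complex.measurable_ofReal.comp this)).aestronglyMeasurable
  · refine (ae_restrict_mem measurableSet_Ioi).mono fun u (hu : 0 < u) => ?_
    rw [norm_smul, Complex.norm_cpow_eq_rpow_re_of_pos hu, Complex.sub_re, Complex.one_re,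
      Complex.norm_of_nonneg (bernoulliKernel_nonneg t hu), Pi.add_apply,
      show z.re + 1 - 1 = z.re - 1 + 1 by ring, Real.rpow_add_one hu.ne' (z.re - 1)]
    calc u ^ (z.re - 1) * bernoulliKernel t u
        ≤ u ^ (z.re - 1) * (Real.exp (-(t * u)) * (1 + u)) := by
          unfold bernoulliKernel
          gcongr
          exact div_one_sub_exp_neg_le hu
      _ = _ := by ring

lemma Bop_cpow_of_re_neg {s : ℂ} (hs : s.re < 0) {t : ℝ} (ht : 0 < t) :
    Bop 1 (fun x : ℝ => (x : ℂ) ^ s) t =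
      (Complex.Gamma (-s))⁻¹ * mellin (fun u => (bernoulliKernel t u : ℂ)) (-s) := by
  have hz : 0 < (-s).re := by simpa using hs
  have hn (n : ℕ) : ‖(n : ℂ) + 1‖ = (n : ℝ) + 1 := by
    exact_mod_cast Complex.norm_natCast (n + 1)
  have hnorm (n : ℕ) : ∫ u in Ioi (0:ℝ),
      ‖(u : ℂ) ^ (-s - 1) • (diffKernel n t u : ℂ) / ((n : ℂ) + 1)‖ =
        diffKernelMoment n t (-s).re / ((n : ℝ) + 1) := by
    simp only [norm_div, hn]
    rw [integral_div, integral_norm_diffKernel]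
  have hsum := hasSum_integral_of_summable_integral_norm
    (μ := volume.restrict (Ioi (0:ℝ)))
    (F := fun (n : ℕ) (u : ℝ) => (u : ℂ) ^ (-s - 1) • (diffKernel n t u : ℂ) / ((n : ℂ) + 1))
    (fun n => Integrable.div_const (mellinConvergent_diffKernel ht
      (by linarith [(Nat.cast_nonneg n : (0:ℝ) ≤ n)])) _)
    (by simpa only [hnorm] using summable_diffKernelMoment_div ht)
  have hint : ∫ u in Ioi (0:ℝ), ∑' n : ℕ,
      (u : ℂ) ^ (-s - 1) • (diffKernel n t u : ℂ) / ((n : ℂ) + 1) =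
        mellin (fun u => (bernoulliKernel t u : ℂ)) (-s) := by
    refine setIntegral_congr_fun measurableSet_Ioi fun u hu => ?_
    have h := (Complex.hasSum_ofReal.mpr (hasSum_diffKernel_div t hu)).mul_left
      ((u : ℂ) ^ (-s - 1))
    push_cast at h
    simpa only [smul_eq_mul, mul_div_assoc] using h.tsum_eq
  rw [hint] at hsum
  refine (HasSum.tsum_eq ?_)
  refine (hsum.mul_left (Complex.Gamma (-s))⁻¹).congr_fun fun n => ?_
  rw [BTerm, Dh_iterate_cpow_of_re_neg hs n ht, integral_div, diffKernelMellin, mellin]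
  have h1 : ((-1 : ℂ) ^ n) * (-1) ^ n = 1 := by rw [← mul_pow]; simp
  linear_combination ((Complex.Gamma (-s))⁻¹ *
    (∫ u in Ioi (0:ℝ), (u : ℂ) ^ (-s - 1) • (diffKernel n t u : ℂ)) / ((n : ℂ) + 1)) * h1

lemma sum_bernoulliKernel (t : ℝ) {m : ℕ} (hm : 0 < m) {u : ℝ} (hu : 0 < u) :
    ∑ k ∈ Finset.range m, bernoulliKernel ((t + k) / m) u = m * bernoulliKernel t ((m : ℝ)⁻¹ * u) := by
  have hm' : (0:ℝ) < m := Nat.cast_pos.mpr hm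
  have hv : 0 < (m : ℝ)⁻¹ * u := by positivity
  set v := (m : ℝ)⁻¹ * u with hv_def
  have hu' : u = m * v := by rw [hv_def]; field_simp
  have hx := (one_sub_exp_neg_pos hv).ne'
  have hpow : Real.exp (-u) = Real.exp (-v) ^ m := by
    rw [← Real.exp_nat_mul, hu']
    ring_nf
  have hy : 1 - Real.exp (-v) ^ m ≠ 0 := hpow ▸ (one_sub_exp_neg_pos hu).ne'
  have hterm (k : ℕ) : Real.exp (-((t + k) / m * u)) =
      Real.exp (-(t * v)) * Real.exp (-v) ^ k := by
    rw [← Real.exp_nat_mul, ← Real.exp_add, hu']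
    congr 1
    field_simp
    ring
  have hgeom := mul_neg_geom_sum (Real.exp (-v)) m
  simp only [bernoulliKernel, hterm]
  rw [← Finset.sum_mul, ← Finset.mul_sum, hpow]
  rw [← hgeom] at hy ⊢
  have hS := right_ne_zero_of_mul hy
  rw [hu']
  field_simp

lemma sum_Bop_cpow_of_re_neg {s : ℂ} (hs : s.re < 0) {t : ℝ} (ht : 0 < t) {m : ℕ} (hm : 0 < m) :
    ∑ k ∈ Finset.range m, Bop 1 (fun x : ℝ => (x : ℂ) ^ s) ((t + k) / m) =
      m * (m : ℂ) ^ (-s) * Bop 1 (fun x : ℝ => (x : ℂ) ^ s) t := by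
  have hm' : (0:ℝ) < m := Nat.cast_pos.mpr hm
  have hz : 0 < (-s).re := by simpa using hs
  have hpos (k : ℕ) : 0 < (t + k) / m := by positivity
  have hscale := mellin_comp_mul_left (fun u => (bernoulliKernel t u : ℂ)) (-s) (inv_pos.mpr hm')
  rw [neg_neg, Complex.ofReal_inv, Complex.ofReal_natCast, Complex.inv_cpow _ _ (by
    rw [Complex.natCast_arg]; exact Real.pi_pos.ne), ← Complex.cpow_neg, smul_eq_mul] at hscale
  simp only [Bop_cpow_of_re_neg hs (hpos _), Bop_cpow_of_re_neg hs ht]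
  rw [← Finset.mul_sum, mul_left_comm, mul_assoc (m : ℂ), ← hscale]
  congr 1
  unfold mellin
  rw [← integral_finsetSum _ fun k _ => mellinConvergent_bernoulliKernel (hpos k) hz,
    ← integral_const_mul]
  refine setIntegral_congr_fun measurableSet_Ioi fun u hu => ?_
  have h : ∑ k ∈ Finset.range m, (bernoulliKernel ((t + k) / m) u : ℂ) =
      m * (bernoulliKernel t ((m : ℝ)⁻¹ * u) : ℂ) := by
    exact_mod_cast sum_bernoulliKernel t hm hu
  simp only [smul_eq_mul]
  rw [← Finset.mul_sum, h]
  ring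

/-- The multiplication theorem for `B` applied to a power function. -/
lemma sum_Bop_cpow (s : ℂ) {t : ℝ} (ht : 0 < t) {m : ℕ} (hm : 0 < m) :
    ∑ k ∈ Finset.range m, Bop 1 (fun x : ℝ => (x : ℂ) ^ s) ((t + k) / m) =
      m * (m : ℂ) ^ (-s) * Bop 1 (fun x : ℝ => (x : ℂ) ^ s) t := by
  have hm' : (0:ℝ) < m := Nat.cast_pos.mpr hm
  have hL : Differentiable ℂ fun s : ℂ =>
      ∑ k ∈ Finset.range m, Bop 1 (fun x : ℝ => (x : ℂ) ^ s) ((t + k) / m) :=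
    Differentiable.fun_sum fun k _ => differentiable_Bop_cpow (by positivity)
  have hR : Differentiable ℂ fun s : ℂ =>
      m * (m : ℂ) ^ (-s) * Bop 1 (fun x : ℝ => (x : ℂ) ^ s) t :=
    (Differentiable.const_mul (differentiable_neg.const_cpow
      (Or.inl (Nat.cast_ne_zero.mpr hm.ne'))) _).mul (differentiable_Bop_cpow ht)
  have hnhds : {s : ℂ | s.re < 0} ∈ nhds (-1 : ℂ) :=
    (isOpen_lt Complex.continuous_re continuous_const).mem_nhds (by simp)
  have h := AnalyticOnNhd.eq_of_eventuallyEq (fun z _ => hL.analyticAt z)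
    (fun z _ => hR.analyticAt z) (z₀ := -1)
    (by filter_upwards [hnhds] with z hz using sum_Bop_cpow_of_re_neg hz ht hm)
  exact congrFun h s

/-- A continuous function on `(0, ∞)` that scales by `m^s` for all positive integers `m`
is a multiple of a power function. -/
lemma eq_cpow_mul_of_scale {s : ℂ} {g : ℝ → ℂ} (hg : ContinuousOn g (Ioi 0))
    (hscale : ∀ m : ℕ, 1 ≤ m → ∀ t ∈ Ioi (0:ℝ), g t = (m : ℂ) ^ (-s) * g (m * t)) :
    EqOn g (fun t => (t : ℂ) ^ s * g 1) (Ioi 0) := by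
  have hmul (m : ℕ) (hm : 1 ≤ m) (t : ℝ) (ht : 0 < t) : g (m * t) = (m : ℂ) ^ s * g t := by
    have h0 : (m : ℂ) ^ s ≠ 0 := by
      simp [Complex.cpow_eq_zero_iff, (Nat.one_le_iff_ne_zero.mp hm)]
    rw [hscale m hm t ht, Complex.cpow_neg, mul_inv_cancel_left₀ h0]
  refine EqOn.of_subset_closure (s := {t : ℝ | 0 < t ∧ ∃ q : ℚ, (q : ℝ) = t}) ?_ hg ?_
    (fun t ht => ht.1) ?_
  · rintro _ ⟨hq, q, rfl⟩
    have hq' : 0 < q := by exact_mod_cast hq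
    have hnum : 0 < q.num := Rat.num_pos.mpr hq'
    obtain ⟨p, hp⟩ := Int.eq_ofNat_of_zero_le hnum.le
    have hp1 : 1 ≤ p := by omega
    have hden : (0:ℝ) < q.den := Nat.cast_pos.mpr q.den_pos
    have hqd : (q.den : ℝ) * q = p := by
      have := Rat.den_mul_eq_num q
      rw [hp] at this
      exact_mod_cast this
    have h1 := hmul q.den q.den_pos q hq
    have h2 := hmul p hp1 1 one_pos
    rw [mul_one] at h2
    rw [hqd, h2] at h1
    have h3 : (p : ℂ) ^ s = (q.den : ℂ) ^ s * ((q : ℝ) : ℂ) ^ s := by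
      have := Complex.mul_cpow_ofReal_nonneg hden.le hq.le s
      rw [← Complex.ofReal_mul, hqd] at this
      exact_mod_cast this
    have h0 : (q.den : ℂ) ^ s ≠ 0 := by simp [Complex.cpow_eq_zero_iff]
    rw [h3, mul_assoc] at h1
    exact (mul_left_cancel₀ h0 h1).symm
  · exact (continuousOn_of_forall_continuousAt fun t (ht : 0 < t) =>
      Complex.continuousAt_ofReal_cpow_const _ _ (Or.inr ht.ne')).mul continuousOn_const
  · intro t (ht : 0 < t)
    refine Metric.mem_closure_iff.mpr fun ε hε => ?_
    obtain ⟨q, h1, h2⟩ := exists_rat_btwn (show t < t + ε by linarith)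
    exact ⟨q, ⟨ht.trans h1, q, rfl⟩, by rw [dist_comm, Real.dist_eq, abs_lt]; constructor <;> linarith⟩

lemma BTerm_eq_mul_of_eqOn {g p : ℝ → ℂ} {c : ℂ} (h : EqOn g (fun t => p t * c) (Ioi 0))
    (n : ℕ) {t : ℝ} (ht : 0 < t) : BTerm 1 g n t = c * BTerm 1 p n t := by
  rw [BTerm, BTerm, mul_left_comm]
  congr 1
  simp only [Dh_iterate_eq_sum, Finset.mul_sum]
  refine Finset.sum_congr rfl fun k _ => ?_
  rw [h (show 0 < t + k • (1:ℝ) by positivity), mul_smul_comm]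
  simp only [mul_comm]

lemma Bop_eq_mul_of_eqOn {g p : ℝ → ℂ} {c : ℂ} (h : EqOn g (fun t => p t * c) (Ioi 0))
    {t : ℝ} (ht : 0 < t) : Bop 1 g t = c * Bop 1 p t := by
  rw [Bop, Bop, ← tsum_mul_left]
  exact tsum_congr fun n => BTerm_eq_mul_of_eqOn h n ht

lemma ALUOn_BTerm_of_eqOn {g p : ℝ → ℂ} {c : ℂ} (h : EqOn g (fun t => p t * c) (Ioi 0))
    (hp : ALUOn (BTerm 1 p) (Ioi 0)) : ALUOn (BTerm 1 g) (Ioi 0) := by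
  refine ⟨fun t ht => ?_, ?_⟩
  · simpa only [BTerm_eq_mul_of_eqOn h _ ht, norm_mul] using (hp.1 t ht).mul_left ‖c‖
  · refine (((uniformContinuous_const_smul c).comp_tendstoLocallyUniformlyOn hp.2).congr
      fun N t ht => ?_).congr_right fun t ht => ?_
    · simp [BTerm_eq_mul_of_eqOn h _ (mem_Ioi.mp ht), Finset.mul_sum]
    · simp only [BTerm_eq_mul_of_eqOn h _ (mem_Ioi.mp ht), tsum_mul_left, Function.comp, smul_eq_mul]

/-- strong renormalizability: with `f ∈ ℋ` (witness `φ`, `φ(u) = o(u^γ)`,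
`Re γ > −1`), `s ≠ 0`, and the scale invariance `f(s,t) = m^{−s} f(s, mt)` for all integers
`m ≥ 1` and `t > 0`: the Bernoulli series of `f_s` converges absolutely and locally uniformly,
and for every `m ≥ 1` and every `n ∈ ℕ`, with
`S_j(n) = (1/s)[(B f_s)(1+n) − m^s (B f_s)((n−j)/m + 1)] − (1/s)(1 − m^s)(B f_s)(1)`,
the average `(1/m) Σ_{j=0}^{m−1} S_j(n)` equals `−(1 − m^s)(1/s)(B f_s)(1)`. -/
theorem stmt16 (f : ℂ → ℝ → ℂ) (φ : ℝ → ℂ) (hf : MemHwith f φ)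
    (γ : ℂ) (hγ : -1 < γ.re) (hsm : SmallO φ γ)
    (s : ℂ) (hs : s ≠ 0)
    (hscale : ∀ m : ℕ, 1 ≤ m → ∀ t ∈ Ioi (0:ℝ), f s t = (m : ℂ) ^ (-s) * f s (m * t)) :
    ALUOn (BTerm 1 (f s)) (Ioi 0) ∧
    ∀ m : ℕ, 1 ≤ m → ∀ n : ℕ,
      (1 / (m : ℂ)) * ∑ j ∈ Finset.range m,
          ((1 / s) * (Bop 1 (f s) (1 + n) -
              (m : ℂ) ^ s * Bop 1 (f s) (((n : ℝ) - (j : ℝ)) / m + 1)) -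
            (1 / s) * (1 - (m : ℂ) ^ s) * Bop 1 (f s) 1) =
        -(1 - (m : ℂ) ^ s) * ((1 / s) * Bop 1 (f s) 1) := by
  have hcont : ContinuousOn (f s) (Ioi 0) := fun t ht =>
    (hf.1 s t ht).continuousAt.continuousWithinAt
  have heq := eq_cpow_mul_of_scale hcont hscale
  refine ⟨ALUOn_BTerm_of_eqOn heq (ALUOn_BTerm_cpow s), fun m hm n => ?_⟩
  have hm' : (0:ℝ) < m := Nat.cast_pos.mpr hm
  have hmC : (m : ℂ) ≠ 0 := Nat.cast_ne_zero.mpr (by omega)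
  have hms : (m : ℂ) ^ s * (m : ℂ) ^ (-s) = 1 := by
    rw [← Complex.cpow_add _ _ hmC, add_neg_cancel, Complex.cpow_zero]
  have hn : (0:ℝ) < 1 + n := by positivity
  have hsum : ∑ j ∈ Finset.range m, Bop 1 (f s) (((n : ℝ) - (j : ℝ)) / m + 1) =
      m * (m : ℂ) ^ (-s) * Bop 1 (f s) (1 + n) := by
    rw [Bop_eq_mul_of_eqOn heq hn, mul_left_comm, ← sum_Bop_cpow s hn hm, Finset.mul_sum,
      ← Finset.sum_range_reflect]
    refine Finset.sum_congr rfl fun j hj => ?_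
    have hj' : j + 1 ≤ m := Finset.mem_range.mp hj
    rw [← Bop_eq_mul_of_eqOn heq (show 0 < (1 + (n : ℝ) + j) / m by positivity)]
    congr 1
    rw [Nat.sub_sub, Nat.cast_sub (by omega)]
    push_cast
    field_simp
    ring
  rw [Finset.sum_sub_distrib, ← Finset.mul_sum, Finset.sum_sub_distrib, ← Finset.mul_sum, hsum]
  simp only [Finset.sum_const, Finset.card_range, nsmul_eq_mul]
  field_simp
  linear_combination (-Bop 1 (f s) (1 + n)) * hms
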